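/- arXiv:math/0411470 — 2 statements merged into one kernel-verified Lean document; each statement's English description precedes it below -/
import Mathlib

section
/- Let G be a Garside group with positive monoid G⁺ and Garside element Δ. Then G is strongly translation discrete with respect to the generating set 𝒟 ∪ 𝒟⁻¹: (i) for every g ∈ G with gᵏ ≠ 1 for all k ≥ 1, t_𝒟(g) > 0; (ii) for every real number r there exists a finite subset F ⊆ G such that every g ∈ G with t_𝒟(g) ≤ r is conjugate to some element of F. -/
/-- `a` left-divides `b` in the monoid `M`. -/
def dvdL {M : Type*} [Monoid M] (a b : M) : Prop := ∃ c, a * c = b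

/-- `a` right-divides `b` in the monoid `M`. -/
def dvdR {M : Type*} [Monoid M] (a b : M) : Prop := ∃ c, c * a = b

/-- `L(a)`, the set of left divisors of `a`. -/
def Lset {M : Type*} [Monoid M] (a : M) : Set M := {x | dvdL x a}

/-- `R(a)`, the set of right divisors of `a`. -/
def Rset {M : Type*} [Monoid M] (a : M) : Set M := {x | dvdR x a}

/-- `a` is an atom: `a ≠ 1` and `a = b * c` implies `b = 1` or `c = 1`. -/
def IsAtomElt {M : Type*} [Monoid M] (a : M) : Prop :=
  a ≠ 1 ∧ ∀ b c : M, a = b * c → b = 1 ∨ c = 1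

/-- `M` is atomic: every element is a finite product of atoms, and the lengths of
expressions of a given element as products of atoms are bounded above. -/
def Atomic (M : Type*) [Monoid M] : Prop :=
  (∀ a : M, ∃ l : List M, (∀ x ∈ l, IsAtomElt x) ∧ l.prod = a) ∧
  (∀ a : M, ∃ N : ℕ, ∀ l : List M, (∀ x ∈ l, IsAtomElt x) → l.prod = a → l.length ≤ N)

/-- `Δ` is a Garside element: `L(Δ) = R(Δ)` and `L(Δ)` generates `M`. -/
def IsGarsideElt {M : Type*} [Monoid M] (Δ : M) : Prop :=
  Lset Δ = Rset Δ ∧ Submonoid.closure (Lset Δ) = ⊤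

/-- `d` is a greatest common lower bound of `a` and `b` with respect to `≤_L`. -/
def IsGlbL {M : Type*} [Monoid M] (a b d : M) : Prop :=
  dvdL d a ∧ dvdL d b ∧ ∀ c : M, dvdL c a → dvdL c b → dvdL c d

/-- `d` is a least common upper bound of `a` and `b` with respect to `≤_L`. -/
def IsLubL {M : Type*} [Monoid M] (a b d : M) : Prop :=
  dvdL a d ∧ dvdL b d ∧ ∀ c : M, dvdL a c → dvdL b c → dvdL d c

/-- `d` is a greatest common lower bound of `a` and `b` with respect to `≤_R`. -/
def IsGlbR {M : Type*} [Monoid M] (a b d : M) : Prop :=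
  dvdR d a ∧ dvdR d b ∧ ∀ c : M, dvdR c a → dvdR c b → dvdR c d

/-- `d` is a least common upper bound of `a` and `b` with respect to `≤_R`. -/
def IsLubR {M : Type*} [Monoid M] (a b d : M) : Prop :=
  dvdR a d ∧ dvdR b d ∧ ∀ c : M, dvdR a c → dvdR b c → dvdR d c

/-- `M` is a Garside monoid: finitely generated, left and right cancellative, atomic,
`≤_L`- and `≤_R`-lattice conditions, and it possesses a Garside element. -/
def IsGarsideMonoid (M : Type*) [Monoid M] : Prop :=
  (∃ S : Set M, S.Finite ∧ Submonoid.closure S = ⊤) ∧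
  (∀ a b c : M, a * b = a * c → b = c) ∧
  (∀ a b c : M, b * a = c * a → b = c) ∧
  Atomic M ∧
  (∀ a b : M, ∃ d, IsGlbL a b d) ∧
  (∀ a b : M, ∃ d, IsLubL a b d) ∧
  (∀ a b : M, ∃ d, IsGlbR a b d) ∧
  (∀ a b : M, ∃ d, IsLubR a b d) ∧
  (∃ Δ : M, IsGarsideElt Δ)

/-- Group-level left divisibility: `a ≤_L b` iff `a⁻¹ * b` is positive. -/
def gdvdL {G : Type*} [Group G] (P : Submonoid G) (a b : G) : Prop := a⁻¹ * b ∈ P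

/-- Group-level right divisibility: `a ≤_R b` iff `b * a⁻¹` is positive. -/
def gdvdR {G : Type*} [Group G] (P : Submonoid G) (a b : G) : Prop := b * a⁻¹ ∈ P

/-- `G` is a Garside group with positive monoid `P` and chosen Garside element `Δ`:
`P` is a Garside monoid, every element of `G` is a fraction `a * b⁻¹` of positive
elements, and `Δ` is a Garside element of `P`. -/
def IsGarsideGroup {G : Type*} [Group G] (P : Submonoid G) (Δ : G) : Prop :=
  IsGarsideMonoid P ∧
  (∀ g : G, ∃ a b : P, g = (a : G) * (b : G)⁻¹) ∧
  ∃ hΔ : Δ ∈ P, IsGarsideElt (⟨Δ, hΔ⟩ : P)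

/-- The set `𝒟 = L(Δ)` of simple elements, viewed as a subset of the group `G`. -/
def simples {G : Type*} [Group G] (P : Submonoid G) (Δ : G) : Set G :=
  {x : G | x ∈ P ∧ x⁻¹ * Δ ∈ P}

/-- The set of lengths of expressions of `g` as a product of elements of `S ∪ S⁻¹`. -/
def wlenSet {G : Type*} [Group G] (S : Set G) (g : G) : Set ℕ :=
  {ℓ : ℕ | ∃ L : List G, (∀ x ∈ L, x ∈ S ∪ S⁻¹) ∧ L.length = ℓ ∧ L.prod = g}

/-- `|g|_S`: the shortest word length of `g` over the alphabet `S ∪ S⁻¹`. -/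
noncomputable def wlen {G : Type*} [Group G] (S : Set G) (g : G) : ℕ :=
  sInf (wlenSet S g)

/-- The translation number of `g` with respect to `S ∪ S⁻¹`, formalized as the
liminf of the sequence `|gⁿ|_S / n`. -/
noncomputable def tnum {G : Type*} [Group G] (S : Set G) (g : G) : ℝ :=
  Filter.liminf (fun n : ℕ => (wlen S (g ^ n) : ℝ) / (n : ℝ)) Filter.atTop

section Monoid

variable {M : Type*} [Monoid M]

theorem IsAtomElt.mem_of_closure_eq_top {S : Set M} (hS : Submonoid.closure S = ⊤) {a : M}
    (ha : IsAtomElt a) : a ∈ S := by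
  have key : ∀ x ∈ Submonoid.closure S, IsAtomElt x → x ∈ S := by
    intro x hx
    induction hx using Submonoid.closure_induction with
    | mem x hx => exact fun _ => hx
    | one => exact fun h => absurd rfl h.1
    | mul x y _ _ ihx ihy =>
      intro h
      rcases h.2 x y rfl with rfl | rfl
      · rw [one_mul] at h ⊢
        exact ihy h
      · rw [mul_one] at h ⊢
        exact ihx h
  exact key a (hS ▸ Submonoid.mem_top a) ha

/-- In a finitely generated atomic monoid every element has finitely many left divisors. -/
theorem Atomic.finite_Lset (hM : Atomic M) (hfg : ∃ S : Set M, S.Finite ∧ Submonoid.closure S = ⊤)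
    (a : M) : (Lset a).Finite := by
  obtain ⟨S, hSfin, hS⟩ := hfg
  obtain ⟨N, hN⟩ := hM.2 a
  have : Finite S := hSfin
  have hfin := (List.finite_length_le S N).image fun l => (l.map Subtype.val).prod
  refine hfin.subset ?_
  rintro x ⟨c, rfl⟩
  obtain ⟨lx, hlx, rfl⟩ := hM.1 x
  obtain ⟨lc, hlc, rfl⟩ := hM.1 c
  refine ⟨lx.attach.map fun y => ⟨y.1, (hlx y.1 y.2).mem_of_closure_eq_top hS⟩, ?_, ?_⟩
  · have := hN (lx ++ lc) (fun y hy => (List.mem_append.1 hy).elim (hlx y) (hlc y)) (by simp)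
    simp only [List.length_append] at this
    simp only [Set.mem_ofPred_eq, List.length_map, List.length_attach]
    omega
  · simp only [List.map_map]
    congr 1
    exact List.attach_map_subtype_val lx

end Monoid

section Group

variable {G : Type*} [Group G]

/-- For commuting elements with positive powers there is a finite nonempty set `S` such that
every `x⁻¹ * s` lies below some element of `S` for `≤_L`. -/
theorem exists_finset_absorbing (P : Submonoid G) (T : Finset G)
    (hcomm : ∀ x ∈ T, ∀ y ∈ T, Commute x y) (hpow : ∀ x ∈ T, ∃ n : ℕ, 1 ≤ n ∧ x ^ n ∈ P) :
    ∃ S : Finset G, S.Nonempty ∧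
      (∀ y, (∀ x ∈ T, Commute y x) → ∀ s ∈ S, Commute y s) ∧
      ∀ x ∈ T, ∀ s ∈ S, ∃ t ∈ S, s⁻¹ * x * t ∈ P := by
  classical
  induction T using Finset.induction_on with
  | empty => exact ⟨{1}, by simp, by simp, by simp⟩
  | insert x T _ ih =>
    simp only [Finset.mem_insert, forall_eq_or_imp] at hcomm hpow
    obtain ⟨S, hne, hcS, hS⟩ := ih (fun y hy => (hcomm.2 y hy).2) hpow.2
    obtain ⟨⟨n, hn, hxn⟩, -⟩ := hpow
    refine ⟨(Finset.range n ×ˢ S).image fun p => (x ^ p.1)⁻¹ * p.2, ?_, ?_, ?_⟩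
    · exact ((Finset.nonempty_range_iff.2 (by omega)).product hne).image _
    · intro y hy s hs
      obtain ⟨⟨j, s⟩, hjs, rfl⟩ := Finset.mem_image.1 hs
      rw [Finset.mem_product] at hjs
      exact (((hy x (by simp)).pow_right j).inv_right).mul_right
        (hcS y (fun w hw => hy w (Finset.mem_insert_of_mem hw)) s hjs.2)
    · intro y hy s hs
      obtain ⟨⟨j, s⟩, hjs, rfl⟩ := Finset.mem_image.1 hs
      simp only [Finset.mem_product, Finset.mem_range] at hjs
      rcases Finset.mem_insert.1 hy with rfl | hy
      · by_cases hj : j + 1 < n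
        · refine ⟨_, Finset.mem_image_of_mem _
            (Finset.mk_mem_product (Finset.mem_range.2 hj) hjs.2), ?_⟩
          have : ((y ^ j)⁻¹ * s)⁻¹ * y * ((y ^ (j + 1))⁻¹ * s) = 1 := by group
          rw [this]
          exact P.one_mem
        · refine ⟨_, Finset.mem_image_of_mem _
            (Finset.mk_mem_product (Finset.mem_range.2 (show 0 < n by omega)) hjs.2), ?_⟩
          have hys : Commute (y ^ n) s := (hcS y (fun w hw => hcomm.1.2 w hw) s hjs.2).pow_left n
          have : ((y ^ j)⁻¹ * s)⁻¹ * y * ((y ^ 0)⁻¹ * s) = s⁻¹ * (y ^ n * s) := by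
            rw [show n = j + 1 by omega]
            group
          rw [this, hys.eq, inv_mul_cancel_left]
          exact hxn
      · obtain ⟨t, ht, hst⟩ := hS y hy s hjs.2
        refine ⟨_, Finset.mem_image_of_mem _ (Finset.mk_mem_product
          (Finset.mem_range.2 hjs.1) ht), ?_⟩
        have hxy : Commute (x ^ j) y := (hcomm.1.2 y hy).pow_left j
        have : ((x ^ j)⁻¹ * s)⁻¹ * y * ((x ^ j)⁻¹ * t) = s⁻¹ * (x ^ j * y) * (x ^ j)⁻¹ * t := by
          group
        rw [this, hxy.eq, ← mul_assoc, mul_inv_cancel_right]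
        exact hst

theorem exists_gdvdL_lub_pair {P : Submonoid G} {z : G}
    (hpos : ∀ g, ∃ m : ℕ, z ^ m * g ∈ P) (hzP : z ∈ P)
    (hlub : ∀ a b : P, ∃ d, IsLubL a b d) (x y : G) :
    ∃ a, gdvdL P x a ∧ gdvdL P y a ∧ ∀ b, gdvdL P x b → gdvdL P y b → gdvdL P a b := by
  obtain ⟨m₁, hm₁⟩ := hpos x
  obtain ⟨m₂, hm₂⟩ := hpos y
  have hx : z ^ (m₁ + m₂) * x ∈ P := by
    rw [add_comm, pow_add, mul_assoc]
    exact P.mul_mem (P.pow_mem hzP _) hm₁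
  have hy : z ^ (m₁ + m₂) * y ∈ P := by
    rw [pow_add, mul_assoc]
    exact P.mul_mem (P.pow_mem hzP _) hm₂
  generalize m₁ + m₂ = m at hx hy
  obtain ⟨d, ⟨u, hu⟩, ⟨v, hv⟩, hd⟩ := hlub ⟨_, hx⟩ ⟨_, hy⟩
  have hu' : z ^ m * x * u = d := congrArg Subtype.val hu
  have hv' : z ^ m * y * v = d := congrArg Subtype.val hv
  refine ⟨(z ^ m)⁻¹ * d, ?_, ?_, ?_⟩
  · rw [gdvdL, ← hu', mul_assoc, inv_mul_cancel_left, inv_mul_cancel_left]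
    exact u.2
  · rw [gdvdL, ← hv', mul_assoc, inv_mul_cancel_left, inv_mul_cancel_left]
    exact v.2
  · intro b hxb hyb
    have hb : z ^ m * b ∈ P := by
      have := P.mul_mem hx hxb
      rwa [mul_assoc, mul_inv_cancel_left] at this
    obtain ⟨w, hw⟩ := hd ⟨_, hb⟩
      ⟨⟨_, hxb⟩, Subtype.ext (by simp [mul_assoc])⟩ ⟨⟨_, hyb⟩, Subtype.ext (by simp [mul_assoc])⟩
    have hw' : d * w = z ^ m * b := congrArg Subtype.val hw
    have : ((z ^ m)⁻¹ * d)⁻¹ * b = w := by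
      rw [mul_inv_rev, inv_inv, mul_assoc, ← hw', inv_mul_cancel_left]
    rw [gdvdL, this]
    exact w.2

theorem exists_gdvdL_lub {P : Submonoid G}
    (hlub : ∀ x y : G, ∃ a, gdvdL P x a ∧ gdvdL P y a ∧
      ∀ b, gdvdL P x b → gdvdL P y b → gdvdL P a b)
    {S : Finset G} (hS : S.Nonempty) :
    ∃ a, (∀ s ∈ S, gdvdL P s a) ∧ ∀ b, (∀ s ∈ S, gdvdL P s b) → gdvdL P a b := by
  induction hS using Finset.Nonempty.cons_induction with
  | singleton x => exact ⟨x, by simp [gdvdL, P.one_mem], by simp⟩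
  | cons x S _ _ ih =>
    obtain ⟨a, ha, hmin⟩ := ih
    obtain ⟨d, hxd, had, hd⟩ := hlub x a
    refine ⟨d, ?_, fun b hb => hd b (hb x (by simp)) (hmin b fun s hs => hb s (by simp [hs]))⟩
    intro s hs
    rcases Finset.mem_cons.1 hs with rfl | hs
    · exact hxd
    · have := P.mul_mem (ha s hs) had
      rwa [mul_assoc, mul_inv_cancel_left] at this

/-- Commuting elements with positive powers are simultaneously conjugate to positive elements. -/
theorem exists_conj_mem {P : Submonoid G}
    (hlub : ∀ x y : G, ∃ a, gdvdL P x a ∧ gdvdL P y a ∧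
      ∀ b, gdvdL P x b → gdvdL P y b → gdvdL P a b)
    (T : Finset G) (hcomm : ∀ x ∈ T, ∀ y ∈ T, Commute x y)
    (hpow : ∀ x ∈ T, ∃ n : ℕ, 1 ≤ n ∧ x ^ n ∈ P) :
    ∃ a, ∀ x ∈ T, a⁻¹ * x * a ∈ P := by
  obtain ⟨S, hne, -, hS⟩ := exists_finset_absorbing P T hcomm hpow
  obtain ⟨a, ha, hmin⟩ := exists_gdvdL_lub hlub hne
  refine ⟨a, fun x hx => ?_⟩
  have := hmin (x * a) fun s hs => by
    obtain ⟨t, ht, hst⟩ := hS x hx s hs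
    have := P.mul_mem hst (ha t ht)
    rwa [mul_assoc, mul_inv_cancel_left, mul_assoc] at this
  rwa [gdvdL, ← mul_assoc] at this

/-- A commuting family whose members all have a power `g ^ n` between `w⁻ⁿ` and `wⁿ`, with `w`
central, is simultaneously conjugate to elements between `w⁻¹` and `w`. -/
theorem exists_conj_between {P : Submonoid G}
    (hlub : ∀ x y : G, ∃ a, gdvdL P x a ∧ gdvdL P y a ∧
      ∀ b, gdvdL P x b → gdvdL P y b → gdvdL P a b)
    {w : G} (hw : ∀ g, Commute w g) (T : Finset G)
    (hcomm : ∀ x ∈ T, ∀ y ∈ T, Commute x y)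
    (hpow : ∀ x ∈ T, ∃ n : ℕ, 1 ≤ n ∧ w ^ n * x ^ n ∈ P ∧ w ^ n * (x ^ n)⁻¹ ∈ P) :
    ∃ a, ∀ x ∈ T, w * (a⁻¹ * x * a) ∈ simples P (w * w) := by
  classical
  obtain ⟨a, ha⟩ := exists_conj_mem hlub
    (T.image (fun x => w * x) ∪ T.image (fun x => w * x⁻¹))
    (by
      intro x hx y hy
      simp only [Finset.mem_union, Finset.mem_image] at hx hy
      rcases hx with ⟨x, hx, rfl⟩ | ⟨x, hx, rfl⟩ <;> rcases hy with ⟨y, hy, rfl⟩ | ⟨y, hy, rfl⟩ <;>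
        refine (hw _).mul_left (((hw _).symm).mul_right ?_) <;>
        simp [hcomm x hx y hy])
    (by
      intro x hx
      simp only [Finset.mem_union, Finset.mem_image] at hx
      rcases hx with ⟨x, hx, rfl⟩ | ⟨x, hx, rfl⟩ <;> obtain ⟨n, hn, h₁, h₂⟩ := hpow x hx <;>
        refine ⟨n, hn, ?_⟩ <;> rw [(hw _).mul_pow]
      · exact h₁
      · rwa [inv_pow])
  refine ⟨a, fun x hx => ?_⟩
  have h₁ := ha (w * x) (Finset.mem_union_left _ (Finset.mem_image_of_mem _ hx))
  have h₂ := ha (w * x⁻¹) (Finset.mem_union_right _ (Finset.mem_image_of_mem _ hx))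
  have e : ∀ y, a⁻¹ * (w * y) * a = w * (a⁻¹ * y * a) := fun y => by
    rw [← mul_assoc, ← (hw a⁻¹).eq]
    simp only [mul_assoc]
  rw [e] at h₁ h₂
  refine ⟨h₁, ?_⟩
  have : (w * (a⁻¹ * x * a))⁻¹ * (w * w) = w * (a⁻¹ * x⁻¹ * a) := by
    rw [mul_inv_rev, mul_assoc, inv_mul_cancel_left, ← (hw _).eq]
    group
  rwa [this]

theorem wlenSet_pow {S : Set G} {g : G} {k : ℕ} (h : k ∈ wlenSet S g) (n : ℕ) :
    n * k ∈ wlenSet S (g ^ n) := by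
  induction n with
  | zero => exact ⟨[], by simp⟩
  | succ n ih =>
    obtain ⟨L, hL, hlen, hprod⟩ := h
    obtain ⟨L', hL', hlen', hprod'⟩ := ih
    refine ⟨L' ++ L, fun x hx => (List.mem_append.1 hx).elim (hL' x) (hL x), ?_, ?_⟩
    · rw [List.length_append, hlen, hlen']
      ring
    · rw [List.prod_append, hprod, hprod', pow_succ]

theorem exists_wlen_lt_of_tnum_lt {S : Set G} {g : G} (hne : (wlenSet S g).Nonempty) {r : ℝ}
    (hr : tnum S g < r) : ∃ n : ℕ, 1 ≤ n ∧ (wlen S (g ^ n) : ℝ) < r * n := by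
  have hbdd : Filter.IsBoundedUnder (· ≤ ·) Filter.atTop
      (fun n : ℕ => (wlen S (g ^ n) : ℝ) / (n : ℝ)) := by
    refine Filter.isBoundedUnder_of ⟨(wlen S g : ℝ), fun n => ?_⟩
    refine div_le_of_le_mul₀ (by positivity) (by positivity) ?_
    have : wlen S (g ^ n) ≤ n * wlen S g := Nat.sInf_le (wlenSet_pow (Nat.sInf_mem hne) n)
    rw [mul_comm]
    exact_mod_cast this
  have hfreq := Filter.frequently_lt_of_liminf_lt hbdd.isCoboundedUnder_ge hr
  obtain ⟨n, hn, hn1⟩ := (hfreq.and_eventually (Filter.eventually_ge_atTop 1)).exists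
  refine ⟨n, hn1, ?_⟩
  rwa [div_lt_iff₀ (by exact_mod_cast hn1)] at hn

end Group

namespace IsGarsideGroup

variable {G : Type*} [Group G] {P : Submonoid G} {Δ : G}

theorem finite_simples (hG : IsGarsideGroup P Δ) {w : G} (hw : w ∈ P) :
    (simples P w).Finite := by
  obtain ⟨⟨hfg, -, -, hat, -⟩, -, -⟩ := hG
  refine ((hat.finite_Lset hfg ⟨w, hw⟩).image Subtype.val).subset ?_
  rintro x ⟨hx, hxw⟩
  exact ⟨⟨x, hx⟩, ⟨⟨_, hxw⟩, Subtype.ext (mul_inv_cancel_left x w)⟩, rfl⟩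

theorem conj_mem_simples (hG : IsGarsideGroup P Δ) {s : G} (hs : s ∈ simples P Δ) :
    Δ⁻¹ * s * Δ ∈ simples P Δ := by
  obtain ⟨-, -, hΔ, hLR, -⟩ := hG
  have hmem : (⟨_, hs.2⟩ : P) ∈ Lset (⟨Δ, hΔ⟩ : P) := by
    rw [hLR]
    exact ⟨⟨s, hs.1⟩, Subtype.ext (mul_inv_cancel_left s Δ)⟩
  obtain ⟨v, hv⟩ := hmem
  have hv' : s⁻¹ * Δ * v = Δ := congrArg Subtype.val hv
  have hveq : Δ⁻¹ * s * Δ = v := by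
    nth_rw 2 [← hv']
    group
  have hvR : v ∈ Lset (⟨Δ, hΔ⟩ : P) := by
    rw [hLR]
    exact ⟨_, hv⟩
  obtain ⟨u, hu⟩ := hvR
  have hu' : (v : G) * u = Δ := congrArg Subtype.val hu
  rw [hveq]
  refine ⟨v.2, ?_⟩
  rw [← hu', inv_mul_cancel_left]
  exact u.2

theorem wlenSet_nonempty (hG : IsGarsideGroup P Δ) (g : G) :
    (wlenSet (simples P Δ) g).Nonempty := by
  obtain ⟨-, hfrac, hΔ, -, hgen⟩ := hG
  have key : ∀ p : P, ∃ L : List G, (∀ x ∈ L, x ∈ simples P Δ) ∧ L.prod = p := by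
    intro p
    obtain ⟨L, hL, rfl⟩ := Submonoid.exists_list_of_mem_closure (hgen ▸ Submonoid.mem_top p)
    refine ⟨L.map Subtype.val, ?_, by simp⟩
    intro x hx
    obtain ⟨y, hy, rfl⟩ := List.mem_map.1 hx
    obtain ⟨c, hc⟩ := hL y hy
    have hc' : (y : G) * c = Δ := congrArg Subtype.val hc
    refine ⟨y.2, ?_⟩
    rw [← hc', inv_mul_cancel_left]
    exact c.2
  obtain ⟨a, b, rfl⟩ := hfrac g
  obtain ⟨A, hA, hA'⟩ := key a
  obtain ⟨B, hB, hB'⟩ := key b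
  refine ⟨_, A ++ (B.map (·⁻¹)).reverse, ?_, rfl, ?_⟩
  · intro x hx
    rcases List.mem_append.1 hx with hx | hx
    · exact Or.inl (hA x hx)
    · obtain ⟨y, hy, rfl⟩ := List.mem_map.1 (List.mem_reverse.1 hx)
      exact Or.inr (by simpa using hB y hy)
  · rw [List.prod_append, hA', ← List.prod_inv_reverse, hB']

/-- Some positive power of the Garside element is central. -/
theorem exists_central_pow (hG : IsGarsideGroup P Δ) :
    ∃ e : ℕ, 1 ≤ e ∧ ∀ g, Commute (Δ ^ e) g := by
  have hΔ : Δ ∈ P := hG.2.2.1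
  have : Finite (simples P Δ) := hG.finite_simples hΔ
  let φ : simples P Δ → simples P Δ := fun s => ⟨_, hG.conj_mem_simples s.2⟩
  have hφ : Function.Injective φ := by
    intro s t hst
    have : Δ⁻¹ * (s : G) * Δ = Δ⁻¹ * t * Δ := congrArg Subtype.val hst
    exact Subtype.ext (mul_left_cancel (mul_right_cancel this))
  let σ : Equiv.Perm (simples P Δ) := Equiv.ofBijective φ (Finite.injective_iff_bijective.1 hφ)
  have hσ : ∀ (n : ℕ) (s : simples P Δ), (((σ ^ n) s : simples P Δ) : G) =
      (Δ ^ n)⁻¹ * s * Δ ^ n := by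
    intro n
    induction n with
    | zero => simp
    | succ n ih =>
      intro s
      rw [pow_succ' σ, Equiv.Perm.mul_apply]
      change Δ⁻¹ * (((σ ^ n) s : simples P Δ) : G) * Δ = _
      rw [ih, pow_succ]
      group
  refine ⟨orderOf σ, orderOf_pos σ, ?_⟩
  have hs : ∀ s ∈ simples P Δ, Commute (Δ ^ orderOf σ) s := by
    intro s hs
    have := hσ (orderOf σ) ⟨s, hs⟩
    rw [pow_orderOf_eq_one, Equiv.Perm.one_apply] at this
    change s = _ at this
    rw [mul_assoc, eq_inv_mul_iff_mul_eq] at this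
    exact this
  intro g
  obtain ⟨_, L, hL, -, rfl⟩ := hG.wlenSet_nonempty g
  refine Commute.list_prod_right _ _ fun x hx => ?_
  rcases hL x hx with h | h
  · exact hs x h
  · simpa using (hs x⁻¹ h).inv_right

theorem pow_mul_mem_of_mem_wlenSet (hG : IsGarsideGroup P Δ) {e : ℕ} (he : 1 ≤ e)
    (hz : ∀ g, Commute (Δ ^ e) g) {g : G} {k : ℕ} (hk : k ∈ wlenSet (simples P Δ) g) :
    (Δ ^ e) ^ k * g ∈ P ∧ (Δ ^ e) ^ k * g⁻¹ ∈ P := by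
  have hΔ : Δ ∈ P := hG.2.2.1
  have hs : ∀ s ∈ simples P Δ, Δ ^ e * s ∈ P ∧ Δ ^ e * s⁻¹ ∈ P := by
    intro s hs
    refine ⟨P.mul_mem (P.pow_mem hΔ e) hs.1, ?_⟩
    obtain ⟨d, rfl⟩ : ∃ d, e = d + 1 := ⟨e - 1, by omega⟩
    rw [(hz _).eq, pow_succ', ← mul_assoc]
    exact P.mul_mem hs.2 (P.pow_mem hΔ d)
  obtain ⟨L, hL, rfl, rfl⟩ := hk
  induction L with
  | nil => simp [P.one_mem]
  | cons x L ih =>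
    have ih := ih fun y hy => hL y (List.mem_cons_of_mem _ hy)
    have hx : Δ ^ e * x ∈ P ∧ Δ ^ e * x⁻¹ ∈ P := by
      rcases hL x List.mem_cons_self with h | h
      · exact hs x h
      · simpa using (hs x⁻¹ h).symm
    generalize Δ ^ e = z at *
    rw [List.length_cons, List.prod_cons]
    constructor
    · have : z ^ (L.length + 1) * (x * L.prod) = z * x * (z ^ L.length * L.prod) := by
        rw [pow_succ', mul_assoc z x, ← mul_assoc x, ← ((hz x).pow_left _).eq]
        simp only [mul_assoc]
      rw [this]
      exact P.mul_mem hx.1 ih.1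
    · have : z ^ (L.length + 1) * (x * L.prod)⁻¹ = z ^ L.length * L.prod⁻¹ * (z * x⁻¹) := by
        rw [pow_succ', mul_inv_rev, ← mul_assoc _ z x⁻¹, ← (hz (z ^ L.length * L.prod⁻¹)).eq]
        simp only [mul_assoc]
      rw [this]
      exact P.mul_mem ih.2 hx.2

theorem exists_lub (hG : IsGarsideGroup P Δ) (x y : G) :
    ∃ a, gdvdL P x a ∧ gdvdL P y a ∧ ∀ b, gdvdL P x b → gdvdL P y b → gdvdL P a b := by
  obtain ⟨e, he, hz⟩ := hG.exists_central_pow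
  refine exists_gdvdL_lub_pair (fun g => ?_) (P.pow_mem hG.2.2.1 e) hG.1.2.2.2.2.2.1 x y
  obtain ⟨k, hk⟩ := hG.wlenSet_nonempty g
  exact ⟨k, (hG.pow_mul_mem_of_mem_wlenSet he hz hk).1⟩

theorem tnum_pos (hG : IsGarsideGroup P Δ) {g : G} (hg : ∀ k : ℕ, 1 ≤ k → g ^ k ≠ 1) :
    0 < tnum (simples P Δ) g := by
  classical
  by_contra! h0
  obtain ⟨e, he, hz⟩ := hG.exists_central_pow
  have hzP : Δ ^ e ∈ P := P.pow_mem hG.2.2.1 e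
  have hF := hG.finite_simples (P.mul_mem hzP hzP)
  obtain ⟨N, hN⟩ : ∃ N, N = hF.toFinset.card + 1 := ⟨_, rfl⟩
  have hNpos : (0 : ℝ) < N := by
    rw [hN]
    positivity
  obtain ⟨n, hn, hlt⟩ := exists_wlen_lt_of_tnum_lt (hG.wlenSet_nonempty g)
    (h0.trans_lt (inv_pos.2 hNpos))
  have hle : N * wlen (simples P Δ) (g ^ n) ≤ n := by
    rw [inv_mul_eq_div, lt_div_iff₀ hNpos, mul_comm] at hlt
    exact_mod_cast hlt.le
  obtain ⟨h₁, h₂⟩ := hG.pow_mul_mem_of_mem_wlenSet he hz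
    (Nat.sInf_mem (hG.wlenSet_nonempty (g ^ n)))
  change _ ^ wlen (simples P Δ) (g ^ n) * _ ∈ P at h₁ h₂
  generalize wlen (simples P Δ) (g ^ n) = k at hle h₁ h₂
  generalize Δ ^ e = z at *
  have hpow : ∀ (y : G) (i : ℕ), i < N → z ^ k * y ∈ P → z ^ n * y ^ i ∈ P := by
    intro y i hi hy
    have hik : k * i ≤ n := by nlinarith
    have : z ^ n * y ^ i = z ^ (n - k * i) * (z ^ k * y) ^ i := by
      rw [((hz y).pow_left k).mul_pow, ← pow_mul, ← mul_assoc, ← pow_add, Nat.sub_add_cancel hik]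
    rw [this]
    exact P.mul_mem (P.pow_mem hzP _) (P.pow_mem hy i)
  obtain ⟨a, ha⟩ := exists_conj_between hG.exists_lub hz ((Finset.range N).image (g ^ ·))
    (by
      intro x hx y hy
      obtain ⟨i, -, rfl⟩ := Finset.mem_image.1 hx
      obtain ⟨j, -, rfl⟩ := Finset.mem_image.1 hy
      exact (Commute.refl g).pow_pow i j)
    (by
      intro x hx
      obtain ⟨i, hi, rfl⟩ := Finset.mem_image.1 hx
      rw [Finset.mem_range] at hi
      refine ⟨n, hn, ?_, ?_⟩
      · rw [pow_right_comm]
        exact hpow _ i hi h₁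
      · rw [pow_right_comm, ← inv_pow]
        exact hpow _ i hi h₂)
  have hmaps : ∀ i ∈ Finset.range N, z * (a⁻¹ * g ^ i * a) ∈ hF.toFinset := fun i hi =>
    hF.mem_toFinset.2 (ha _ (Finset.mem_image_of_mem _ hi))
  obtain ⟨i, -, j, -, hij, heq⟩ :=
    Finset.exists_ne_map_eq_of_card_lt_of_maps_to (by rw [Finset.card_range]; omega) hmaps
  have heq' : g ^ i = g ^ j := mul_left_cancel (mul_right_cancel (mul_left_cancel heq))
  have hne : ∀ i j : ℕ, i < j → g ^ i ≠ g ^ j := fun i j hlt h => by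
    refine hg (j - i) (by omega) ?_
    rw [pow_sub g hlt.le, h, mul_inv_cancel]
  rcases hij.lt_or_gt with h | h
  · exact hne i j h heq'
  · exact hne j i h heq'.symm

theorem exists_finset_isConj (hG : IsGarsideGroup P Δ) (r : ℝ) :
    ∃ F : Finset G, ∀ g : G, tnum (simples P Δ) g ≤ r → ∃ f ∈ F, IsConj g f := by
  classical
  obtain ⟨e, he, hz⟩ := hG.exists_central_pow
  have hzP : Δ ^ e ∈ P := P.pow_mem hG.2.2.1 e
  obtain ⟨R, hR⟩ := exists_nat_gt r
  have hwP : (Δ ^ e) ^ R ∈ P := P.pow_mem hzP R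
  have hF := hG.finite_simples (P.mul_mem hwP hwP)
  refine ⟨hF.toFinset.image fun x => ((Δ ^ e) ^ R)⁻¹ * x, fun g hg => ?_⟩
  obtain ⟨n, hn, hlt⟩ := exists_wlen_lt_of_tnum_lt (hG.wlenSet_nonempty g) (hg.trans_lt hR)
  have hle : wlen (simples P Δ) (g ^ n) ≤ R * n := by exact_mod_cast hlt.le
  obtain ⟨h₁, h₂⟩ := hG.pow_mul_mem_of_mem_wlenSet he hz
    (Nat.sInf_mem (hG.wlenSet_nonempty (g ^ n)))
  change _ ^ wlen (simples P Δ) (g ^ n) * _ ∈ P at h₁ h₂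
  have hpow : ∀ y, (Δ ^ e) ^ wlen (simples P Δ) (g ^ n) * y ∈ P →
      ((Δ ^ e) ^ R) ^ n * y ∈ P := by
    intro y hy
    rw [← pow_mul (Δ ^ e), ← Nat.sub_add_cancel hle, pow_add, mul_assoc]
    exact P.mul_mem (P.pow_mem hzP _) hy
  obtain ⟨a, ha⟩ := exists_conj_between hG.exists_lub (fun y => (hz y).pow_left R) {g}
    (by simp) (by simpa using ⟨n, hn, hpow _ h₁, hpow _ h₂⟩)
  refine ⟨a⁻¹ * g * a, Finset.mem_image.2 ⟨_, hF.mem_toFinset.2 (ha g (by simp)), ?_⟩, ?_⟩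
  · exact inv_mul_cancel_left _ _
  · exact isConj_iff.2 ⟨a⁻¹, by simp⟩

end IsGarsideGroup

/-- **Theorem 7.2 (Main Theorem).** All Garside groups are strongly translation
discrete: translation numbers of non-torsion elements are strictly positive, and
for any real number `r` there are only finitely many conjugacy classes of elements
whose translation number is at most `r`. -/
theorem garside_strongly_translation_discrete {G : Type*} [Group G]
    (P : Submonoid G) (Δ : G) (hG : IsGarsideGroup P Δ) :
    (∀ g : G, (∀ k : ℕ, 1 ≤ k → g ^ k ≠ 1) → 0 < tnum (simples P Δ) g) ∧
    (∀ r : ℝ, ∃ F : Finset G, ∀ g : G, tnum (simples P Δ) g ≤ r →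
      ∃ f ∈ F, IsConj g f) :=
  ⟨fun _ hg => hG.tnum_pos hg, hG.exists_finset_isConj⟩
end

section
/- Let G be a Garside group with positive monoid G⁺ and Garside element Δ, and let g ∈ G with gᵏ ≠ 1 for all k ≥ 1. Then: (i) the set {n ≥ 1 : xⁿ = g for some x ∈ G} is finite; (ii) for every n ≥ 1 there exists a finite subset F ⊆ G such that every x ∈ G with xⁿ = g is conjugate to some element of F (i.e. there are only finitely many conjugacy classes of n-th roots of g). -/
section GroupOrder

variable {G : Type*} [Group G] {P : Submonoid G}

theorem gdvdL_trans {a b d : G} (hab : gdvdL P a b) (hbd : gdvdL P b d) : gdvdL P a d := by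
  have h := P.mul_mem hab hbd
  unfold gdvdL
  convert h using 1
  group

theorem gdvdL_mul_left_iff (g a b : G) : gdvdL P (g * a) (g * b) ↔ gdvdL P a b := by
  unfold gdvdL
  rw [show (g * a)⁻¹ * (g * b) = a⁻¹ * b by group]

theorem dvdL_coe_iff (a b : P) : dvdL a b ↔ gdvdL P (a : G) b := by
  constructor
  · rintro ⟨t, rfl⟩
    simp [gdvdL]
  · intro h
    exact ⟨⟨_, h⟩, Subtype.ext (by simp)⟩

/-- `d` is a greatest lower bound of `a` and `b` for `gdvdL P`. -/
def IsMeet (P : Submonoid G) (a b d : G) : Prop :=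
  gdvdL P d a ∧ gdvdL P d b ∧ ∀ e, gdvdL P e a → gdvdL P e b → gdvdL P e d

theorem IsMeet.mul_left {a b d : G} (h : IsMeet P a b d) (g : G) :
    IsMeet P (g * a) (g * b) (g * d) := by
  refine ⟨(gdvdL_mul_left_iff g _ _).2 h.1, (gdvdL_mul_left_iff g _ _).2 h.2.1, fun e ha hb ↦ ?_⟩
  have key : ∀ x, gdvdL P e (g * x) ↔ gdvdL P (g⁻¹ * e) x := fun x ↦ by
    rw [← gdvdL_mul_left_iff g (g⁻¹ * e) x, mul_inv_cancel_left]
  rw [key] at ha hb ⊢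
  exact h.2.2 _ ha hb

theorem IsGlbL.mul_left {a b d : P} (h : IsGlbL a b d) (hglb : ∀ a b : P, ∃ d, IsGlbL a b d)
    (p : P) : IsGlbL (p * a) (p * b) (p * d) := by
  have cancel : ∀ x y : P, dvdL (p * x) (p * y) ↔ dvdL x y := fun x y ↦ by
    rw [dvdL_coe_iff, dvdL_coe_iff, Submonoid.coe_mul, Submonoid.coe_mul, gdvdL_mul_left_iff]
  refine ⟨(cancel _ _).2 h.1, (cancel _ _).2 h.2.1, fun e ha hb ↦ ?_⟩
  obtain ⟨m, hma, hmb, hm⟩ := hglb (p * a) (p * b)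
  obtain ⟨t, rfl⟩ := hm p ⟨a, rfl⟩ ⟨b, rfl⟩
  have hpt : dvdL (p * t) (p * d) :=
    (cancel _ _).2 (h.2.2 _ ((cancel _ _).1 hma) ((cancel _ _).1 hmb))
  rw [dvdL_coe_iff] at hpt ⊢
  exact gdvdL_trans ((dvdL_coe_iff _ _).1 (hm e ha hb)) hpt

theorem exists_isMeet {c : G} (hcP : c ∈ P) (hc : ∀ x, Commute c x)
    (hfrac : ∀ g : G, ∃ k : ℕ, g * c ^ k ∈ P) (hglb : ∀ a b : P, ∃ d, IsGlbL a b d) (a b : G) :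
    ∃ d, IsMeet P a b d := by
  have up : ∀ {g : G} {k : ℕ} (m : ℕ), g * c ^ k ∈ P → c ^ (k + m) * g ∈ P := fun {g k} m h ↦ by
    rw [((hc g).pow_left _).eq, pow_add, ← mul_assoc]
    exact P.mul_mem h (P.pow_mem hcP m)
  obtain ⟨k, hk⟩ := hfrac a
  obtain ⟨l, hl⟩ := hfrac b
  have ha : c ^ (k + l) * a ∈ P := up l hk
  have hb : c ^ (k + l) * b ∈ P := by rw [add_comm]; exact up k hl
  obtain ⟨d, hd⟩ := hglb ⟨_, ha⟩ ⟨_, hb⟩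
  suffices h : IsMeet P (c ^ (k + l) * a) (c ^ (k + l) * b) d by
    refine ⟨_, by simpa using h.mul_left (c ^ (k + l))⁻¹⟩
  refine ⟨(dvdL_coe_iff _ _).1 hd.1, (dvdL_coe_iff _ _).1 hd.2.1, fun e hea heb ↦ ?_⟩
  obtain ⟨m, hm⟩ := hfrac e
  have hm' : c ^ m * e ∈ P := up 0 hm
  have h := (hd.mul_left hglb ⟨_, P.pow_mem hcP m⟩).2.2 ⟨_, hm'⟩
    ((dvdL_coe_iff _ _).2 ((gdvdL_mul_left_iff _ _ _).2 hea))
    ((dvdL_coe_iff _ _).2 ((gdvdL_mul_left_iff _ _ _).2 heb))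
  exact (gdvdL_mul_left_iff (c ^ m) _ _).1 ((dvdL_coe_iff _ _).1 h)

theorem exists_meet_le (hmeet : ∀ a b : G, ∃ d, IsMeet P a b d) (f : ℕ → G) (n : ℕ) :
    ∃ d, (∀ j ≤ n, gdvdL P d (f j)) ∧ ∀ e, (∀ j ≤ n, gdvdL P e (f j)) → gdvdL P e d := by
  induction n with
  | zero =>
    refine ⟨f 0, fun j hj ↦ ?_, fun e he ↦ he 0 le_rfl⟩
    obtain rfl : j = 0 := by omega
    simp [gdvdL]
  | succ n ih =>
    obtain ⟨d, hd, hd'⟩ := ih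
    obtain ⟨m, hm1, hm2, hm3⟩ := hmeet d (f (n + 1))
    refine ⟨m, fun j hj ↦ ?_, fun e he ↦
      hm3 e (hd' e fun j hj ↦ he j (by omega)) (he _ le_rfl)⟩
    rcases Nat.lt_or_ge n j with h | h
    · obtain rfl : j = n + 1 := by omega
      exact hm2
    · exact gdvdL_trans hm1 (hd j h)

theorem exists_gdvdL_mul_of_pow (hmeet : ∀ a b : G, ∃ d, IsMeet P a b d) {z w : G} {n : ℕ}
    (hn : 1 ≤ n) (h : gdvdL P z (w ^ n * z)) :
    ∃ d, gdvdL P d (w * d) ∧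
      ∀ u, Commute u w → gdvdL P z (u * z) → gdvdL P d (u * d) := by
  obtain ⟨d, hd, hd'⟩ := exists_meet_le hmeet (fun j ↦ w ^ j * z) (n - 1)
  have key : ∀ u, (∀ j ≤ n - 1, gdvdL P d (u * (w ^ j * z))) → gdvdL P d (u * d) := by
    intro u hu
    rw [← gdvdL_mul_left_iff u⁻¹, inv_mul_cancel_left]
    refine hd' _ fun j hj ↦ ?_
    rw [← gdvdL_mul_left_iff u, mul_inv_cancel_left]
    exact hu j hj
  refine ⟨d, key w fun j hj ↦ ?_, fun u huw hu ↦ key u fun j hj ↦ ?_⟩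
  · rw [← mul_assoc, ← pow_succ']
    rcases Nat.lt_or_ge (n - 1) (j + 1) with hlt | hge
    · obtain rfl : n = j + 1 := by omega
      have h0 := hd 0 (Nat.zero_le _)
      rw [pow_zero, one_mul] at h0
      exact gdvdL_trans h0 h
    · exact hd _ hge
  · rw [← mul_assoc, (huw.pow_right j).eq, mul_assoc]
    exact gdvdL_trans (hd j hj) ((gdvdL_mul_left_iff _ _ _).2 hu)

/-- Finitely many commuting elements that each have a positive power are simultaneously
conjugate to positive elements. -/
theorem exists_simultaneous_conj (hmeet : ∀ a b : G, ∃ d, IsMeet P a b d) (s : Finset G)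
    (hcomm : ∀ v ∈ s, ∀ w ∈ s, Commute v w) (hpow : ∀ w ∈ s, ∃ n : ℕ, 1 ≤ n ∧ w ^ n ∈ P) :
    ∃ z : G, ∀ w ∈ s, z⁻¹ * w * z ∈ P := by
  classical
  suffices H : ∃ z : G, (∀ w ∈ s, gdvdL P z (w * z)) ∧
      ∀ u ∈ P, (∀ w ∈ s, Commute u w) → gdvdL P z (u * z) by
    obtain ⟨z, hz, -⟩ := H
    exact ⟨z, fun w hw ↦ by simpa [gdvdL, mul_assoc] using hz w hw⟩
  induction s using Finset.induction_on with
  | empty => exact ⟨1, by simp, fun u hu _ ↦ by simpa [gdvdL] using hu⟩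
  | insert w s _ ih =>
    simp only [Finset.mem_insert, forall_eq_or_imp] at hcomm hpow ⊢
    obtain ⟨z, hz, hz'⟩ := ih (fun v hv ↦ (hcomm.2 v hv).2) hpow.2
    obtain ⟨n, hn, hwn⟩ := hpow.1
    obtain ⟨d, hdw, hd⟩ := exists_gdvdL_mul_of_pow hmeet hn
      (hz' _ hwn fun v hv ↦ (hcomm.1.2 v hv).pow_left n)
    exact ⟨d, ⟨hdw, fun v hv ↦ hd v (hcomm.2 v hv).1 (hz v hv)⟩,
      fun u hu huw ↦ hd u huw.1 (hz' u hu huw.2)⟩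

end GroupOrder

section Roots

variable {G : Type*} [Group G] {P : Submonoid G} {c : G}

/-- The elements lying between `c⁻ʳ` and `cʳ`, for a central element `c`. -/
def centralInterval (P : Submonoid G) (c : G) (r : ℕ) : Set G :=
  {y | y * c ^ r ∈ P ∧ y⁻¹ * c ^ r ∈ P}

theorem centralInterval_finite (hc : ∀ x, Commute c x)
    (hfin : ∀ s : ℕ, {y | y ∈ P ∧ y⁻¹ * c ^ s ∈ P}.Finite) (r : ℕ) :
    (centralInterval P c r).Finite := by
  refine ((hfin (2 * r)).preimage (mul_left_injective (c ^ r)).injOn).subset ?_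
  rintro y ⟨h1, h2⟩
  refine ⟨h1, ?_⟩
  have h : (y * c ^ r)⁻¹ * c ^ (2 * r) = y⁻¹ * c ^ r := by
    rw [((hc y).symm.pow_right r).eq]
    simp only [mul_inv_rev, two_mul, pow_add]
    group
  change (y * c ^ r)⁻¹ * c ^ (2 * r) ∈ P
  rwa [h]

theorem exists_conj_mem_centralInterval (hc : ∀ x, Commute c x)
    (hmeet : ∀ a b : G, ∃ d, IsMeet P a b d) (r : ℕ) (s : Finset G)
    (hcomm : ∀ v ∈ s, ∀ w ∈ s, Commute v w)
    (hpow : ∀ w ∈ s, (∃ n : ℕ, 1 ≤ n ∧ (w * c ^ r) ^ n ∈ P) ∧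
      ∃ n : ℕ, 1 ≤ n ∧ (w⁻¹ * c ^ r) ^ n ∈ P) :
    ∃ z : G, ∀ w ∈ s, z⁻¹ * w * z ∈ centralInterval P c r := by
  classical
  have hcr : ∀ x, Commute (c ^ r) x := fun x ↦ (hc x).pow_left r
  obtain ⟨z, hz⟩ := exists_simultaneous_conj hmeet
    (s.image (fun w ↦ w * c ^ r) ∪ s.image (fun w ↦ w⁻¹ * c ^ r)) (by
      have aux : ∀ {v w : G}, Commute v w → Commute (v * c ^ r) (w * c ^ r) := fun h ↦
        (h.mul_right (hcr _).symm).mul_left (hcr _)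
      simp only [Finset.mem_union, Finset.mem_image]
      rintro _ (⟨v, hv, rfl⟩ | ⟨v, hv, rfl⟩) _ (⟨w, hw, rfl⟩ | ⟨w, hw, rfl⟩)
      · exact aux (hcomm v hv w hw)
      · exact aux (hcomm v hv w hw).inv_right
      · exact aux (hcomm v hv w hw).inv_left
      · exact aux (hcomm v hv w hw).inv_inv) (by
      simp only [Finset.mem_union, Finset.mem_image]
      rintro _ (⟨v, hv, rfl⟩ | ⟨v, hv, rfl⟩)
      · exact (hpow v hv).1
      · exact (hpow v hv).2)
  refine ⟨z, fun w hw ↦ ⟨?_, ?_⟩⟩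
  · have h := hz (w * c ^ r)
      (by simp only [Finset.mem_union, Finset.mem_image]; exact .inl ⟨w, hw, rfl⟩)
    rwa [mul_assoc, mul_assoc w, (hcr z).eq, ← mul_assoc, ← mul_assoc] at h
  · have h := hz (w⁻¹ * c ^ r)
      (by simp only [Finset.mem_union, Finset.mem_image]; exact .inr ⟨w, hw, rfl⟩)
    rw [mul_assoc, mul_assoc w⁻¹, (hcr z).eq, ← mul_assoc, ← mul_assoc] at h
    rwa [show (z⁻¹ * w * z)⁻¹ = z⁻¹ * w⁻¹ * z by group]

theorem mul_pow_mem_of_le (hcP : c ∈ P) {g : G} {k l : ℕ} (hkl : k ≤ l) (h : g * c ^ k ∈ P) :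
    g * c ^ l ∈ P := by
  rw [← Nat.add_sub_cancel' hkl, pow_add, ← mul_assoc]
  exact P.mul_mem h (P.pow_mem hcP _)

theorem root_conj_mem_centralInterval (hcP : c ∈ P) (hc : ∀ x, Commute c x)
    (hmeet : ∀ a b : G, ∃ d, IsMeet P a b d) {g x : G} {r n : ℕ}
    (hg : g ∈ centralInterval P c r) (hn : 1 ≤ n) (hx : x ^ n = g) :
    ∃ f ∈ centralInterval P c r, IsConj x f := by
  have hrn : r ≤ r * n := Nat.le_mul_of_pos_right r hn
  obtain ⟨z, hz⟩ := exists_conj_mem_centralInterval hc hmeet r {x}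
    (by simp) (by
      simp only [Finset.mem_singleton, forall_eq]
      refine ⟨⟨n, hn, ?_⟩, n, hn, ?_⟩
      · rw [((hc x).pow_left r).symm.mul_pow, hx, ← pow_mul]
        exact mul_pow_mem_of_le hcP hrn hg.1
      · rw [((hc x⁻¹).pow_left r).symm.mul_pow, inv_pow, hx, ← pow_mul]
        exact mul_pow_mem_of_le hcP hrn hg.2)
  exact ⟨_, hz x (Finset.mem_singleton_self x), isConj_iff.2 ⟨z⁻¹, by simp⟩⟩

/-- If `g` has arbitrarily high roots conjugate to `f`, then every power of `f` has a power
above any negative power of `c`. -/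
theorem exists_zpow_mul_pow_mem (hcP : c ∈ P) (hc : ∀ x, Commute c x)
    (hfrac : ∀ g : G, ∃ k : ℕ, g * c ^ k ∈ P) {f g : G}
    (hf : ∀ N : ℕ, ∃ n, N ≤ n ∧ IsConj (f ^ n) g) (k : ℤ) :
    ∃ j : ℕ, 1 ≤ j ∧ (f ^ k * c) ^ j ∈ P := by
  obtain ⟨q, hq⟩ := hfrac (g ^ k)
  obtain ⟨n, hn, hconj⟩ := hf (q + 1)
  obtain ⟨h, hh⟩ := isConj_iff.1 hconj
  obtain ⟨a, ha⟩ := hfrac h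
  obtain ⟨b, hb⟩ := hfrac h⁻¹
  obtain ⟨m, hm⟩ : ∃ m, m = a + b + 1 := ⟨_, rfl⟩
  refine ⟨n * m, Nat.mul_pos (by omega) (by omega), ?_⟩
  have hfg : (f ^ k) ^ (n * m) = h⁻¹ * (g ^ k) ^ m * h := by
    have h1 : f ^ n = h⁻¹ * g * h⁻¹⁻¹ := by rw [← hh]; group
    have h2 : (f ^ k) ^ (n * m) = ((f ^ n) ^ k) ^ m := by
      simp only [← zpow_natCast, ← zpow_mul]
      congr 1
      push_cast
      ring
    rw [h2, h1, conj_zpow, conj_pow, inv_inv]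
  have hexp : b + q * m + a ≤ n * m := by
    have := Nat.mul_le_mul_right m hn
    rw [add_mul] at this
    omega
  rw [(hc _).symm.mul_pow, hfg]
  apply mul_pow_mem_of_le hcP hexp
  have hprod : h⁻¹ * (g ^ k) ^ m * h * c ^ (b + q * m + a) =
      h⁻¹ * c ^ b * (g ^ k * c ^ q) ^ m * (h * c ^ a) := by
    rw [((hc (g ^ k)).pow_left q).symm.mul_pow, ← pow_mul, pow_add, pow_add]
    have e1 := ((hc ((g ^ k) ^ m)).pow_left b).eq
    have e2 := ((hc h).pow_left (q * m)).eq
    have e3 := ((hc h).pow_left b).eq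
    calc _ = h⁻¹ * (g ^ k) ^ m * (h * c ^ b) * c ^ (q * m) * c ^ a := by simp only [mul_assoc]
      _ = h⁻¹ * ((g ^ k) ^ m * c ^ b) * (h * c ^ (q * m)) * c ^ a := by
        rw [← e3]; simp only [mul_assoc]
      _ = _ := by rw [← e1, ← e2]; simp only [mul_assoc]
  rw [hprod]
  exact P.mul_mem (P.mul_mem hb (P.pow_mem hq m)) ha

theorem exists_pow_eq_one (hc : ∀ x, Commute c x)
    (hmeet : ∀ a b : G, ∃ d, IsMeet P a b d)
    (hfin : (centralInterval P c 1).Finite) {f : G}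
    (hf : ∀ k : ℤ, ∃ j : ℕ, 1 ≤ j ∧ (f ^ k * c) ^ j ∈ P) :
    ∃ k : ℕ, 1 ≤ k ∧ f ^ k = 1 := by
  classical
  obtain ⟨z, hz⟩ := exists_conj_mem_centralInterval hc hmeet 1
    ((Finset.range (hfin.toFinset.card + 1)).image (fun k ↦ f ^ k)) (by
      simp only [Finset.mem_image]
      rintro _ ⟨k, -, rfl⟩ _ ⟨l, -, rfl⟩
      exact Commute.pow_pow_self f k l) (by
      simp only [Finset.mem_image]
      rintro _ ⟨k, -, rfl⟩
      refine ⟨?_, ?_⟩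
      · simpa using hf k
      · simpa using hf (-k))
  obtain ⟨k, hk, l, hl, hkl, heq⟩ := Finset.exists_ne_map_eq_of_card_lt_of_maps_to
    (s := Finset.range (hfin.toFinset.card + 1)) (t := hfin.toFinset)
    (f := fun k ↦ z⁻¹ * f ^ k * z) (by simp)
    (fun k hk ↦ hfin.mem_toFinset.2 (hz _ (Finset.mem_image_of_mem _ hk)))
  have heq' : f ^ k = f ^ l := mul_left_cancel (mul_right_cancel heq)
  rcases Nat.lt_or_gt_of_ne hkl with h | h
  · exact ⟨l - k, by omega, by rw [pow_sub _ h.le, heq', mul_inv_cancel]⟩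
  · exact ⟨k - l, by omega, by rw [pow_sub _ h.le, heq', mul_inv_cancel]⟩

theorem finitely_many_roots_of_central (hcP : c ∈ P) (hc : ∀ x, Commute c x)
    (hfrac : ∀ g : G, ∃ k : ℕ, g * c ^ k ∈ P) (hmeet : ∀ a b : G, ∃ d, IsMeet P a b d)
    (hfin : ∀ s : ℕ, {y | y ∈ P ∧ y⁻¹ * c ^ s ∈ P}.Finite)
    (g : G) (hg : ∀ k : ℕ, 1 ≤ k → g ^ k ≠ 1) :
    {n : ℕ | 1 ≤ n ∧ ∃ x : G, x ^ n = g}.Finite ∧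
    (∀ n : ℕ, 1 ≤ n → ∃ F : Finset G, ∀ x : G, x ^ n = g → ∃ f ∈ F, IsConj x f) := by
  obtain ⟨k, hk⟩ := hfrac g
  obtain ⟨l, hl⟩ := hfrac g⁻¹
  have hgr : g ∈ centralInterval P c (k + l) :=
    ⟨mul_pow_mem_of_le hcP (by omega) hk, mul_pow_mem_of_le hcP (by omega) hl⟩
  have hI := centralInterval_finite hc hfin
  refine ⟨?_, fun n hn ↦ ⟨(hI (k + l)).toFinset, fun x hx ↦ ?_⟩⟩
  · have hsub : {n : ℕ | 1 ≤ n ∧ ∃ x : G, x ^ n = g} ⊆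
        ⋃ f ∈ centralInterval P c (k + l), {n : ℕ | IsConj (f ^ n) g} := by
      rintro n ⟨hn, x, hx⟩
      obtain ⟨f, hf, hxf⟩ := root_conj_mem_centralInterval hcP hc hmeet hgr hn hx
      simp only [Set.mem_iUnion]
      exact ⟨f, hf, hx ▸ (hxf.pow n).symm⟩
    refine ((hI (k + l)).biUnion fun f _ ↦ ?_).subset hsub
    by_contra hinf
    have hf : ∀ N : ℕ, ∃ n, N ≤ n ∧ IsConj (f ^ n) g := fun N ↦ by
      obtain ⟨n, hn, hNn⟩ := Set.Infinite.exists_gt hinf N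
      exact ⟨n, hNn.le, hn⟩
    obtain ⟨j, hj, hj1⟩ := exists_pow_eq_one hc hmeet (hI 1)
      (exists_zpow_mul_pow_mem hcP hc hfrac hf)
    obtain ⟨n, -, hn⟩ := hf 0
    apply hg j hj
    have h := hn.pow j
    rwa [← pow_mul, mul_comm, pow_mul, hj1, one_pow, isConj_one_right] at h
  · simpa using root_conj_mem_centralInterval hcP hc hmeet hgr hn hx

end Roots

section Simples

theorem finite_setOf_isAtomElt {M : Type*} [Monoid M]
    (hfg : ∃ S : Set M, S.Finite ∧ Submonoid.closure S = ⊤) :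
    {a : M | IsAtomElt a}.Finite := by
  obtain ⟨S, hS, hgen⟩ := hfg
  refine hS.subset fun a ha ↦ ?_
  obtain ⟨l, hl, rfl⟩ := Submonoid.exists_list_of_mem_closure
    (show a ∈ Submonoid.closure S by rw [hgen]; trivial)
  induction l with
  | nil => exact absurd rfl ha.1
  | cons x l ih =>
    rw [List.prod_cons] at ha ⊢
    rcases ha.2 _ _ rfl with h | h
    · rw [h, one_mul] at ha ⊢
      exact ih (fun y hy ↦ hl y (List.mem_cons_of_mem _ hy)) ha
    · rw [h, mul_one]
      exact hl x List.mem_cons_self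

theorem Lset_finite {M : Type*} [Monoid M]
    (hfg : ∃ S : Set M, S.Finite ∧ Submonoid.closure S = ⊤) (hat : Atomic M) (a : M) :
    (Lset a).Finite := by
  have hA : Finite {a : M | IsAtomElt a} := finite_setOf_isAtomElt hfg
  obtain ⟨N, hN⟩ := hat.2 a
  refine ((List.finite_length_le {a : M | IsAtomElt a} N).image
    (fun l ↦ (l.map Subtype.val).prod)).subset ?_
  rintro x ⟨y, rfl⟩
  obtain ⟨l, hl, rfl⟩ := hat.1 x
  obtain ⟨m, hm, rfl⟩ := hat.1 y
  have hlen := hN (l ++ m) (fun z hz ↦ (List.mem_append.1 hz).elim (hl z) (hm z)) (by simp)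
  rw [List.length_append] at hlen
  refine ⟨l.attachWith _ hl, ?_, congrArg List.prod (List.attachWith_map_subtype_val hl)⟩
  change (l.attachWith _ hl).length ≤ N
  rw [List.length_attachWith]
  omega

variable {G : Type*} [Group G] {P : Submonoid G}

theorem conj_mem_of_Lset_eq_Rset {Δ : P} (hΔ : Lset Δ = Rset Δ) {x : P} (hx : x ∈ Lset Δ) :
    ∃ x' ∈ Lset Δ, (x : G) * Δ = Δ * x' := by
  obtain ⟨y, hy⟩ := hx
  have hyR : y ∈ Lset Δ := by rw [hΔ]; exact ⟨x, hy⟩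
  obtain ⟨x', hx'⟩ := hyR
  refine ⟨x', by rw [hΔ]; exact ⟨y, hx'⟩, ?_⟩
  have h : x * Δ = Δ * x' := by
    conv_lhs => rw [← hx']
    conv_rhs => rw [← hy]
    rw [mul_assoc]
  exact_mod_cast congrArg Subtype.val h

theorem exists_pow_commute {Δ : P} (hΔ : IsGarsideElt Δ) (hfin : (Lset Δ).Finite)
    (hfrac : ∀ g : G, ∃ a b : P, g = (a : G) * (b : G)⁻¹) :
    ∃ e : ℕ, 1 ≤ e ∧ ∀ g : G, Commute ((Δ : G) ^ e) g := by
  have := hfin.to_subtype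
  choose! φ hφ hφeq using fun (x : P) hx ↦ conj_mem_of_Lset_eq_Rset (x := x) hΔ.1 hx
  let ψ : Lset Δ → Lset Δ := fun x ↦ ⟨φ x, hφ x x.2⟩
  have hψ : Function.Injective ψ := fun x y hxy ↦ by
    have h : φ x = φ y := congrArg Subtype.val hxy
    have hx := hφeq x x.2
    rw [h, ← hφeq y y.2] at hx
    exact Subtype.ext (Subtype.ext (mul_right_cancel hx))
  let σ : Equiv.Perm (Lset Δ) := Equiv.ofBijective ψ (Finite.injective_iff_bijective.1 hψ)
  have hσ : ∀ (k : ℕ) (x : Lset Δ),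
      ((x : P) : G) * (Δ : G) ^ k = (Δ : G) ^ k * (((σ ^ k) x : Lset Δ) : P) := by
    intro k
    induction k with
    | zero => simp
    | succ k ih =>
      intro x
      have h1 : ((((σ ^ k) x : Lset Δ) : P) : G) * Δ
          = Δ * ((σ ((σ ^ k) x) : Lset Δ) : P) := hφeq _ ((σ ^ k) x).2
      rw [pow_succ (Δ : G), ← mul_assoc, ih, mul_assoc, h1, pow_succ' σ, Equiv.Perm.mul_apply,
        mul_assoc]
  refine ⟨orderOf σ, orderOf_pos σ, ?_⟩
  have hP : ∀ p : P, Commute ((Δ : G) ^ orderOf σ) p := fun p ↦ by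
    have hp : p ∈ Submonoid.closure (Lset Δ) := by rw [hΔ.2]; trivial
    induction hp using Submonoid.closure_induction with
    | mem x hx =>
      have h := hσ (orderOf σ) ⟨x, hx⟩
      rw [pow_orderOf_eq_one] at h
      exact h.symm
    | one => exact Commute.one_right _
    | mul x y _ _ hx hy => exact hx.mul_right hy
  intro g
  obtain ⟨a, b, rfl⟩ := hfrac g
  exact (hP a).mul_right (hP b).inv_right

theorem exists_mul_pow_mem {Δ : P} (hΔ : IsGarsideElt Δ) {e : ℕ} (he : 1 ≤ e)
    (hc : ∀ g : G, Commute ((Δ : G) ^ e) g)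
    (hfrac : ∀ g : G, ∃ a b : P, g = (a : G) * (b : G)⁻¹) (g : G) :
    ∃ k : ℕ, g * ((Δ : G) ^ e) ^ k ∈ P := by
  have hP : ∀ p : P, ∃ k : ℕ, (p : G)⁻¹ * ((Δ : G) ^ e) ^ k ∈ P := fun p ↦ by
    have hp : p ∈ Submonoid.closure (Lset Δ) := by rw [hΔ.2]; trivial
    induction hp using Submonoid.closure_induction with
    | mem x hx =>
      obtain ⟨y, hy⟩ := hx
      refine ⟨1, ?_⟩
      rw [pow_one, ← Nat.sub_add_cancel he, pow_succ', ← mul_assoc]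
      refine P.mul_mem ?_ (P.pow_mem Δ.2 _)
      rw [← hy]
      simp
    | one => exact ⟨0, by simp⟩
    | mul x y _ _ hx hy =>
      obtain ⟨k, hk⟩ := hx
      obtain ⟨l, hl⟩ := hy
      refine ⟨l + k, ?_⟩
      have h := P.mul_mem hl hk
      rw [mul_assoc, ← mul_assoc _ (x : G)⁻¹, ((hc (x : G)⁻¹).pow_left l).eq] at h
      rw [Submonoid.coe_mul, mul_inv_rev, pow_add]
      simpa only [mul_assoc] using h
  obtain ⟨a, b, rfl⟩ := hfrac g
  obtain ⟨k, hk⟩ := hP b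
  exact ⟨k, by rw [mul_assoc]; exact P.mul_mem a.2 hk⟩

end Simples

/-- **Theorem 8.1.** Let `G` be a Garside group and `g ∈ G` non-torsion. Then
(i) there are only finitely many `n ≥ 1` such that `g` has an `n`-th root, and
(ii) for each `n ≥ 1` there are only finitely many conjugacy classes of `n`-th
roots of `g`. -/
theorem finitely_many_roots {G : Type*} [Group G] (P : Submonoid G) (Δ : G)
    (hG : IsGarsideGroup P Δ) (g : G) (hg : ∀ k : ℕ, 1 ≤ k → g ^ k ≠ 1) :
    {n : ℕ | 1 ≤ n ∧ ∃ x : G, x ^ n = g}.Finite ∧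
    (∀ n : ℕ, 1 ≤ n → ∃ F : Finset G, ∀ x : G, x ^ n = g → ∃ f ∈ F, IsConj x f) := by
  obtain ⟨⟨hfg, -, -, hat, hglb, -⟩, hfrac, hΔP, hΔ⟩ := hG
  obtain ⟨e, he, hc⟩ := exists_pow_commute hΔ (Lset_finite hfg hat _) hfrac
  have hcP : Δ ^ e ∈ P := P.pow_mem hΔP e
  have hfrac' := exists_mul_pow_mem hΔ he hc hfrac
  refine finitely_many_roots_of_central hcP hc hfrac' (exists_isMeet hcP hc hfrac' hglb)
    (fun s ↦ ?_) g hg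
  refine ((Lset_finite hfg hat ⟨_, P.pow_mem hcP s⟩).image Subtype.val).subset ?_
  rintro y ⟨hy, hys⟩
  exact ⟨⟨y, hy⟩, (dvdL_coe_iff _ _).2 hys, rfl⟩
end
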